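/- Let n ≥ 1 and let p = Σ_{k=0}^{n} c_k y^{n−k+1} z^k ∈ ℝ[y,z] be completely log-concave. Then the sequence c_0, …, c_n satisfies: for every k with 1 < k < n, (c_k / C(n+1,k))² ≥ (c_{k−1} / C(n+1,k−1)) · (c_{k+1} / C(n+1,k+1)). -/

import Mathlib

open MvPolynomial

/-- The directional derivative `D_a p = ∑ i, a i * ∂_{z i} p`. -/
noncomputable def dirDeriv {n : ℕ} (a : Fin n → ℝ) (p : MvPolynomial (Fin n) ℝ) :
    MvPolynomial (Fin n) ℝ :=
  ∑ i : Fin n, MvPolynomial.C (a i) * MvPolynomial.pderiv i p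

/-- Iterated directional derivatives `D_{a₁} ⋯ D_{a_k} p`. -/
noncomputable def dirDerivs {n : ℕ} (as : List (Fin n → ℝ)) (p : MvPolynomial (Fin n) ℝ) :
    MvPolynomial (Fin n) ℝ :=
  as.foldr dirDeriv p

/-- `p` is nonnegative on the nonnegative orthant and `log p` is concave there
(`x ^ t` denotes the real power `rpow`). -/
def LogConcaveOn {n : ℕ} (p : MvPolynomial (Fin n) ℝ) : Prop :=
  (∀ x : Fin n → ℝ, (∀ i, 0 ≤ x i) → 0 ≤ MvPolynomial.eval x p) ∧
    ∀ x y : Fin n → ℝ, (∀ i, 0 ≤ x i) → (∀ i, 0 ≤ y i) → ∀ t : ℝ, 0 ≤ t → t ≤ 1 →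
      MvPolynomial.eval x p ^ t * MvPolynomial.eval y p ^ (1 - t) ≤
        MvPolynomial.eval (fun i => t * x i + (1 - t) * y i) p

/-- `p` is completely log-concave. -/
def CompletelyLogConcave {n : ℕ} (p : MvPolynomial (Fin n) ℝ) : Prop :=
  ∀ as : List (Fin n → ℝ), (∀ a ∈ as, ∀ i, 0 ≤ a i) → LogConcaveOn (dirDerivs as p)

/-- Generating polynomial of a set function. -/
noncomputable def genPoly {n : ℕ} (f : Finset (Fin n) → ℝ) : MvPolynomial (Fin n) ℝ :=
  ∑ S : Finset (Fin n), MvPolynomial.C (f S) * ∏ i ∈ S, MvPolynomial.X i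

/-- Generating polynomial of a set function restricted to subsets of `V`. -/
noncomputable def genPolyOn {n : ℕ} (V : Finset (Fin n)) (f : Finset (Fin n) → ℝ) :
    MvPolynomial (Fin n) ℝ :=
  ∑ S ∈ V.powerset, MvPolynomial.C (f S) * ∏ i ∈ S, MvPolynomial.X i

/-- The `d`-homogeneous restriction `f^{(d)}` of a set function. -/
def homRestrict {n : ℕ} (f : Finset (Fin n) → ℝ) (d : ℕ) : Finset (Fin n) → ℝ :=
  fun S => if S.card = d then f S else 0

/-- `g` is a coverage function on subsets of `V`. -/
def IsCoverageOn {n : ℕ} (V : Finset (Fin n)) (g : Finset (Fin n) → ℝ) : Prop :=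
  ∃ (m : ℕ) (w : Fin m → ℝ) (A : Fin n → Finset (Fin m)),
    (∀ u, 0 ≤ w u) ∧ ∀ T ⊆ V, g T = ∑ u ∈ T.biUnion A, w u

/-- `ℓ` is a (nonnegative) linear set function on subsets of `V`. -/
def IsLinearOn {n : ℕ} (V : Finset (Fin n)) (ℓ : Finset (Fin n) → ℝ) : Prop :=
  (∀ i ∈ V, 0 ≤ ℓ {i}) ∧ ∀ T ⊆ V, ℓ T = ∑ i ∈ T, ℓ {i}

/-- `p` cannot be written as a sum of two nonzero polynomials in disjoint sets of variables. -/
def Indecomposable {n : ℕ} (p : MvPolynomial (Fin n) ℝ) : Prop :=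
  ¬ ∃ q r : MvPolynomial (Fin n) ℝ, q ≠ 0 ∧ r ≠ 0 ∧ Disjoint q.vars r.vars ∧ p = q + r

/-- `f` is 2-coverage with respect to `d`. -/
def TwoCoverageWrt {n : ℕ} (f : Finset (Fin n) → ℝ) (d : ℕ) : Prop :=
  (∀ τ : Finset (Fin n), τ.card ≤ d - 2 →
      Indecomposable (genPolyOn (Finset.univ \ τ) fun S => homRestrict f d (τ ∪ S))) ∧
  (∀ τ : Finset (Fin n), τ.card = d - 2 →
      ∃ V : Finset (Fin n), V ⊆ Finset.univ \ τ ∧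
        ∃ g ℓ : Finset (Fin n) → ℝ,
          IsCoverageOn V g ∧ IsLinearOn V ℓ ∧ (∀ i ∈ V, ℓ {i} ≤ g {i}) ∧
          ∀ T ⊆ Finset.univ \ τ, T.card = 2 →
            f (τ ∪ T) = if T ⊆ V then g T - ℓ T / 2 else 0)

/-- `f` is strongly 2-coverage. -/
def StronglyTwoCoverage {n : ℕ} (f : Finset (Fin n) → ℝ) : Prop :=
  ∀ τ : Finset (Fin n), τ.card ≤ n - 2 →
    ∃ g : Finset (Fin n) → ℝ, IsCoverageOn (Finset.univ \ τ) g ∧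
      ∀ S ⊆ Finset.univ \ τ, S.Nonempty → S.card ≤ 2 → f (τ ∪ S) = g S + f τ

/-- Monotone set function. -/
def MonotoneSet {n : ℕ} (f : Finset (Fin n) → ℝ) : Prop :=
  ∀ ⦃A B : Finset (Fin n)⦄, A ⊆ B → f A ≤ f B

/-- Submodular set function (diminishing returns). -/
def SubmodularSet {n : ℕ} (f : Finset (Fin n) → ℝ) : Prop :=
  ∀ ⦃S T : Finset (Fin n)⦄, S ⊆ T → ∀ i : Fin n,
    f (insert i T) - f T ≤ f (insert i S) - f S

/-- `levelSum f i = ∑_{|S| = i} f S`. -/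
noncomputable def levelSum {n : ℕ} (f : Finset (Fin n) → ℝ) (i : ℕ) : ℝ :=
  ∑ S ∈ Finset.powersetCard i (Finset.univ : Finset (Fin n)), f S

/-- A matroid on ground set `Fin n`, given by its independent sets. -/
structure FinMatroid (n : ℕ) where
  Indep : Finset (Fin n) → Prop
  indep_empty : Indep ∅
  indep_subset : ∀ ⦃S T : Finset (Fin n)⦄, Indep T → S ⊆ T → Indep S
  indep_exchange : ∀ ⦃S T : Finset (Fin n)⦄, Indep S → Indep T → S.card < T.card →
    ∃ i ∈ T, i ∉ S ∧ Indep (insert i S)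

open Classical in
/-- The rank of `S`: the maximum cardinality of an independent subset of `S`. -/
noncomputable def FinMatroid.rank {n : ℕ} (M : FinMatroid n) (S : Finset (Fin n)) : ℕ :=
  (S.powerset.filter fun T => M.Indep T).sup Finset.card

lemma dirDerivs_append {n : ℕ} (as bs : List (Fin n → ℝ)) (p : MvPolynomial (Fin n) ℝ) :
    dirDerivs (as ++ bs) p = dirDerivs as (dirDerivs bs p) := by
  simp [dirDerivs]

lemma dirDeriv_single {n : ℕ} (i : Fin n) (p : MvPolynomial (Fin n) ℝ) :
    dirDeriv (Pi.single i 1) p = pderiv i p := by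
  rw [dirDeriv, Finset.sum_eq_single i]
  · simp
  · intro j _ hj
    simp [Pi.single_eq_of_ne hj]
  · simp

lemma dirDerivs_replicate_single {n : ℕ} (i : Fin n) (m : ℕ) (p : MvPolynomial (Fin n) ℝ) :
    dirDerivs (List.replicate m (Pi.single i 1)) p = (pderiv i)^[m] p := by
  induction m with
  | zero => rfl
  | succ m ih =>
    rw [Function.iterate_succ_apply', ← ih, ← dirDeriv_single]
    rfl

lemma iterate_pderiv_zero (m u v : ℕ) (c : ℝ) :
    (pderiv (0 : Fin 2))^[m] (C c * X 0 ^ u * X 1 ^ v) =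
      C (c * u.descFactorial m) * X 0 ^ (u - m) * X 1 ^ v := by
  induction m with
  | zero => simp
  | succ m ih =>
    rw [Function.iterate_succ_apply', ih, Nat.descFactorial_succ]
    simp [Derivation.leibniz, Derivation.leibniz_pow, pderiv_X, Nat.sub_sub]
    ring

lemma iterate_pderiv_one (m u v : ℕ) (c : ℝ) :
    (pderiv (1 : Fin 2))^[m] (C c * X 0 ^ u * X 1 ^ v) =
      C (c * v.descFactorial m) * X 0 ^ u * X 1 ^ (v - m) := by
  induction m with
  | zero => simp
  | succ m ih =>
    rw [Function.iterate_succ_apply', ih, Nat.descFactorial_succ]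
    simp [Derivation.leibniz, Derivation.leibniz_pow, pderiv_X, Nat.sub_sub]
    ring

lemma iterate_pderiv_sum {σ ι : Type*} (i : σ) (m : ℕ) (s : Finset ι)
    (f : ι → MvPolynomial σ ℝ) :
    (pderiv i)^[m] (∑ k ∈ s, f k) = ∑ k ∈ s, (pderiv i)^[m] (f k) := by
  induction m with
  | zero => rfl
  | succ m ih => simp only [Function.iterate_succ_apply', ih, map_sum]

/-- Evaluation of the quadratic form left after differentiating a binary form `m` times in the
first variable and `j` times in the second. -/
lemma eval_dirDerivs_binary_form {m : ℕ} (hm : 1 ≤ m) (j : ℕ) (c : ℕ → ℝ) (x : Fin 2 → ℝ) :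
    eval x (dirDerivs (List.replicate m (Pi.single 0 1) ++ List.replicate j (Pi.single 1 1))
      (∑ k ∈ Finset.range (j + 1 + m + 1), C (c k) *
        X (0 : Fin 2) ^ (j + 1 + m - k + 1) * X (1 : Fin 2) ^ k)) =
      c j * (j.factorial * (m + 2).factorial) * x 0 ^ 2 / 2 +
      c (j + 1) * ((j + 1).factorial * (m + 1).factorial) * x 0 * x 1 +
      c (j + 2) * ((j + 2).factorial * m.factorial) * x 1 ^ 2 / 2 := by
  rw [dirDerivs_append, dirDerivs_replicate_single, dirDerivs_replicate_single]
  simp only [iterate_pderiv_sum, iterate_pderiv_zero, iterate_pderiv_one, map_sum]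
  have hsub : ({j, j + 1, j + 2} : Finset ℕ) ⊆ Finset.range (j + 1 + m + 1) := by
    intro k
    simp only [Finset.mem_insert, Finset.mem_singleton, Finset.mem_range]
    omega
  rw [← Finset.sum_subset hsub]
  · have e1 : j + 1 + m - j + 1 = m + 2 := by omega
    have e2 : j + 1 + m - (j + 1) + 1 = m + 1 := by omega
    have e3 : j + 1 + m - (j + 2) + 1 = m := by omega
    have d2 (r : ℕ) : ((r + 2).descFactorial r : ℝ) = (r + 2).factorial / 2 := by
      have := Nat.factorial_mul_descFactorial (show r ≤ r + 2 by omega)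
      rw [← this, Nat.add_sub_cancel_left]
      simp
    have d1 (r : ℕ) : ((r + 1).descFactorial r : ℝ) = (r + 1).factorial := by
      have := Nat.factorial_mul_descFactorial (show r ≤ r + 1 by omega)
      rw [← this, Nat.add_sub_cancel_left]
      simp
    rw [Finset.sum_insert (by simp), Finset.sum_insert (by simp), Finset.sum_singleton,
      e1, e2, e3]
    simp only [map_mul, map_pow, eval_C, eval_X, d1, d2, Nat.descFactorial_self,
      Nat.add_sub_cancel_left, Nat.sub_self]
    ring
  · intro k hk hk'
    simp only [Finset.mem_insert, Finset.mem_singleton, Finset.mem_range] at hk hk'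
    rcases lt_or_ge k j with hkj | hkj
    · simp [Nat.descFactorial_of_lt hkj]
    · simp [Nat.descFactorial_of_lt (show j + 1 + m - k + 1 < m by omega)]

lemma div_choose_eq_mul_factorial_div {N i l : ℕ} (h : i + l = N) (a : ℝ) :
    a / (N.choose i : ℝ) = a * (i.factorial * l.factorial) / N.factorial := by
  subst h
  rw [Nat.cast_add_choose, div_div_eq_mul_div]

/-- A log-concave binary quadratic form has nonpositive determinant. -/
lemma LogConcaveOn.mul_le_sq_of_eval_eq {q : MvPolynomial (Fin 2) ℝ} (hq : LogConcaveOn q)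
    {a b d : ℝ}
    (h : ∀ x : Fin 2 → ℝ, eval x q = a * x 0 ^ 2 / 2 + b * x 0 * x 1 + d * x 1 ^ 2 / 2) :
    a * d ≤ b ^ 2 := by
  have ha : 0 ≤ a := by
    have := hq.1 ![1, 0] (by simp [Fin.forall_fin_two])
    simp [h] at this
    linarith
  have hd : 0 ≤ d := by
    have := hq.1 ![0, 1] (by simp [Fin.forall_fin_two])
    simp [h] at this
    linarith
  rcases ha.eq_or_lt with rfl | ha
  · simpa using sq_nonneg b
  rcases hd.eq_or_lt with rfl | hd
  · simpa using sq_nonneg b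
  have key := hq.2 ![√d, 0] ![0, √a] (by simp [Fin.forall_fin_two])
    (by simp [Fin.forall_fin_two]) (1 / 2) (by norm_num) (by norm_num)
  have had : 0 < a * d := mul_pos ha hd
  have e1 : eval ![√d, 0] q = a * d / 2 := by simp [h, Real.sq_sqrt hd.le]
  have e2 : eval ![0, √a] q = a * d / 2 := by simp [h, Real.sq_sqrt ha.le, mul_comm]
  rw [e1, e2, ← Real.rpow_add (by positivity), h] at key
  norm_num at key
  have sa := Real.sq_sqrt ha.le
  have sd := Real.sq_sqrt hd.le
  have hs : 0 < √a * √d := by positivity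
  have hsq : (√a * √d) ^ 2 = a * d := by rw [mul_pow, sa, sd]
  have hb : (√a * √d) ^ 2 ≤ b * (√a * √d) := by
    rw [hsq]
    nlinarith
  have hb' : √a * √d ≤ b := by
    rw [pow_two] at hb
    exact le_of_mul_le_mul_right hb hs
  rw [← hsq]
  exact pow_le_pow_left₀ hs.le hb' 2

/-- If `p = ∑_{k=0}^{n} c_k y^{n-k+1} z^k` is completely log-concave
(`y` is variable `0`, `z` is variable `1`), then `c_0, …, c_n` is ultra log-concave. -/
theorem stmt_6 (n : ℕ) (hn : 1 ≤ n) (c : ℕ → ℝ)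
    (h : CompletelyLogConcave (∑ k ∈ Finset.range (n + 1),
        MvPolynomial.C (c k) * MvPolynomial.X (0 : Fin 2) ^ (n - k + 1) *
          MvPolynomial.X (1 : Fin 2) ^ k)) :
    ∀ k : ℕ, 1 < k → k < n →
      (c (k - 1) / ((n + 1).choose (k - 1) : ℝ)) *
          (c (k + 1) / ((n + 1).choose (k + 1) : ℝ)) ≤
        (c k / ((n + 1).choose k : ℝ)) ^ 2 := by
  intro k hk hkn
  obtain ⟨j, rfl⟩ : ∃ j, k = j + 1 := ⟨k - 1, by omega⟩
  obtain ⟨m, rfl⟩ := Nat.exists_eq_add_of_lt hkn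
  have hlc := h (List.replicate (m + 1) (Pi.single 0 1) ++ List.replicate j (Pi.single 1 1)) (by
    intro a ha i
    rcases List.mem_append.1 ha with ha | ha <;> rw [List.eq_of_mem_replicate ha] <;>
      simp only [Pi.single_apply] <;> split_ifs <;> norm_num)
  have hdet := hlc.mul_le_sq_of_eval_eq
    (eval_dirDerivs_binary_form (m := m + 1) (by omega) j c)
  rw [Nat.add_sub_cancel,
    div_choose_eq_mul_factorial_div (i := j) (l := m + 1 + 2) (by omega),
    div_choose_eq_mul_factorial_div (i := j + 1) (l := m + 1 + 1) (by omega),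
    div_choose_eq_mul_factorial_div (i := j + 1 + 1) (l := m + 1) (by omega),
    div_mul_div_comm, div_pow, ← pow_two]
  gcongr
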